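/- Let n ≥ 5 and let β be a nonzero weight for Gr(2,n) with rank(β) ≤ 2(n−2) − 4. Then either β₃ = β₄ = … = β_n = 0, or β = (r, r, 1, 0, …, 0) for some integer r ≥ 1, or β = (s, s, 1, 1, …, 1, 0) for some integer s ≥ 1 (the tail (β₃,…,β_n) being (1,…,1,0)). -/

import Mathlib

open Finset

/-- Weyl dimension formula `D_r` for `sl(r)`, applied to the entries
`β 0, …, β (r-1)` (0-indexed versions of `β₁, …, β_r`). -/
def slDim (r : ℕ) (β : ℕ → ℚ) : ℚ :=
  ∏ i ∈ Finset.range r, ∏ j ∈ Finset.range r,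
    if i < j then ((j : ℚ) - (i : ℚ) + β i - β j) / ((j : ℚ) - (i : ℚ)) else 1

/-- Weyl dimension formula `C_m` for `sp(2m)`. -/
def spDim (m : ℕ) (β : ℕ → ℚ) : ℚ :=
  slDim m β *
    ∏ i ∈ Finset.range m, ∏ j ∈ Finset.range m,
      if i ≤ j then
        ((2 * m : ℚ) - (i : ℚ) - (j : ℚ) + β i + β j) /
          ((2 * m : ℚ) - (i : ℚ) - (j : ℚ))
      else 1

/-- Weyl dimension formula `B_m` for `so(2m+1)`. -/
def soOddDim (m : ℕ) (β : ℕ → ℚ) : ℚ :=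
  slDim m β *
    ∏ i ∈ Finset.range m, ∏ j ∈ Finset.range m,
      if i ≤ j then
        ((2 * m : ℚ) - 1 - (i : ℚ) - (j : ℚ) + β i + β j) /
          ((2 * m : ℚ) - 1 - (i : ℚ) - (j : ℚ))
      else 1

/-- Weyl dimension formula `E_m` for `so(2m)`. -/
def soEvenDim (m : ℕ) (β : ℕ → ℚ) : ℚ :=
  slDim m β *
    ∏ i ∈ Finset.range m, ∏ j ∈ Finset.range m,
      if i < j then
        ((2 * m : ℚ) - 2 - (i : ℚ) - (j : ℚ) + β i + β j) /
          ((2 * m : ℚ) - 2 - (i : ℚ) - (j : ℚ))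
      else 1

/-- The tuple determined by a list, extended by zeros. -/
def lw (l : List ℚ) : ℕ → ℚ := fun i => l.getD i 0

/-- `β₁ + ⋯ + β_k` (the sum of the first `k` entries). -/
def headSum (k : ℕ) (β : ℕ → ℚ) : ℚ := ∑ i ∈ Finset.range k, β i

/-- A weight for the ordinary Grassmannian `Gr(k,n)`: integers
`β₁ ≥ β₂ ≥ ⋯ ≥ β_n = 0`, extended by zeros beyond position `n`. -/
def IsGrWeight (n : ℕ) (β : ℕ → ℚ) : Prop :=
  (∀ i, ∃ z : ℤ, β i = (z : ℚ)) ∧ (∀ i j, i ≤ j → β j ≤ β i) ∧ ∀ i, n - 1 ≤ i → β i = 0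

/-- `rank(β) = D_k(β₁,…,β_k) ⬝ D_{n-k}(β_{k+1},…,β_n)` on `Gr(k,n)`. -/
def grRank (k n : ℕ) (β : ℕ → ℚ) : ℚ := slDim k β * slDim (n - k) (fun i => β (k + i))

/-- `dex(β) = (|β|₁/k − |β|₂/(n−k)) ⬝ rank(β)` on `Gr(k,n)`. -/
def grDex (k n : ℕ) (β : ℕ → ℚ) : ℚ :=
  (headSum k β / (k : ℚ) -
      (∑ i ∈ Finset.range (n - k), β (k + i)) / ((n : ℚ) - (k : ℚ))) * grRank k n β

/-- A weight for the symplectic Grassmannian `IGr(k,2n)`: integers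
`β₁ ≥ ⋯ ≥ β_n ≥ 0`, extended by zeros beyond position `n`. -/
def IsIGrWeight (n : ℕ) (β : ℕ → ℚ) : Prop :=
  (∀ i, ∃ z : ℤ, β i = (z : ℚ)) ∧ (∀ i j, i ≤ j → β j ≤ β i) ∧ ∀ i, n ≤ i → β i = 0

/-- `rank(β) = D_k(β₁,…,β_k) ⬝ C_{n-k}(β_{k+1},…,β_n)` on `IGr(k,2n)`. -/
def igrRank (k n : ℕ) (β : ℕ → ℚ) : ℚ := slDim k β * spDim (n - k) (fun i => β (k + i))

/-- `dex(β) = ((β₁+⋯+β_k)/k) ⬝ rank(β)` on `IGr(k,2n)`. -/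
def igrDex (k n : ℕ) (β : ℕ → ℚ) : ℚ := headSum k β / (k : ℚ) * igrRank k n β

/-- A weight for the odd orthogonal Grassmannian `OGr(k,2n+1)`:
`β₁ ≥ ⋯ ≥ β_n ≥ 0`, all entries integers or all half-odd-integers,
extended by zeros beyond position `n`. -/
def IsOGrOddWeight (n : ℕ) (β : ℕ → ℚ) : Prop :=
  ((∀ i, i < n → ∃ z : ℤ, β i = (z : ℚ)) ∨
    (∀ i, i < n → ∃ z : ℤ, β i = (z : ℚ) + 1/2)) ∧
  (∀ i j, i ≤ j → j < n → β j ≤ β i) ∧ (∀ i, i < n → 0 ≤ β i) ∧ ∀ i, n ≤ i → β i = 0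

/-- `rank(β) = D_k(β₁,…,β_k) ⬝ B_{n-k}(β_{k+1},…,β_n)` on `OGr(k,2n+1)`. -/
def ogrOddRank (k n : ℕ) (β : ℕ → ℚ) : ℚ :=
  slDim k β * soOddDim (n - k) (fun i => β (k + i))

/-- `dex(β) = ((β₁+⋯+β_k)/k) ⬝ rank(β)` on `OGr(k,2n+1)`. -/
def ogrOddDex (k n : ℕ) (β : ℕ → ℚ) : ℚ := headSum k β / (k : ℚ) * ogrOddRank k n β

/-- A weight for the even orthogonal Grassmannian `OGr(k,2n)`:
`β₁ ≥ ⋯ ≥ β_{n-1} ≥ |β_n|`, all entries integers or all half-odd-integers,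
extended by zeros beyond position `n`. -/
def IsOGrEvenWeight (n : ℕ) (β : ℕ → ℚ) : Prop :=
  ((∀ i, i < n → ∃ z : ℤ, β i = (z : ℚ)) ∨
    (∀ i, i < n → ∃ z : ℤ, β i = (z : ℚ) + 1/2)) ∧
  (∀ i j, i ≤ j → j + 1 < n → β j ≤ β i) ∧
  (∀ i, i + 1 < n → |β (n - 1)| ≤ β i) ∧ ∀ i, n ≤ i → β i = 0

/-- `rank(β) = D_k(β₁,…,β_k) ⬝ E_{n-k}(β_{k+1},…,β_n)` on `OGr(k,2n)`. -/
def ogrEvenRank (k n : ℕ) (β : ℕ → ℚ) : ℚ :=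
  slDim k β * soEvenDim (n - k) (fun i => β (k + i))

/-- `dex(β) = ((β₁+⋯+β_k)/k) ⬝ rank(β)` on `OGr(k,2n)`. -/
def ogrEvenDex (k n : ℕ) (β : ℕ → ℚ) : ℚ := headSum k β / (k : ℚ) * ogrEvenRank k n β

/-- Replace the last entry `β_n` by its negative. -/
def negLast (n : ℕ) (β : ℕ → ℚ) : ℕ → ℚ := fun i => if i = n - 1 then -β i else β i

/-- Splitting off the factors of the Weyl dimension formula that involve the first entry. -/
theorem slDim_succ (r : ℕ) (β : ℕ → ℚ) :
    slDim (r + 1) β = (∏ j ∈ range r, ((j : ℚ) + 1 + β 0 - β (j + 1)) / ((j : ℚ) + 1)) *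
      slDim r (fun i => β (i + 1)) := by
  unfold slDim
  rw [prod_range_succ', mul_comm]
  congr 1
  · rw [prod_range_succ']
    simp
  · refine prod_congr rfl fun i _ => ?_
    rw [prod_range_succ']
    simp

/-- The Weyl dimension formula is invariant under passing to the dual weight. -/
theorem slDim_reflect (r : ℕ) (β : ℕ → ℚ) :
    slDim r (fun i => -β (r - 1 - i)) = slDim r β := by
  unfold slDim
  rw [prod_comm, ← prod_range_reflect]
  refine prod_congr rfl fun i hi => ?_
  rw [← prod_range_reflect]
  refine prod_congr rfl fun j hj => ?_
  rw [mem_range] at hi hj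
  dsimp only
  rw [Nat.sub_sub_self (by omega : i ≤ r - 1), Nat.sub_sub_self (by omega : j ≤ r - 1)]
  by_cases h : i < j
  · rw [if_pos h, if_pos (by omega), Nat.cast_sub (by omega : i ≤ r - 1),
      Nat.cast_sub (by omega : j ≤ r - 1)]
    congr 1 <;> ring
  · rw [if_neg h, if_neg (by omega)]

theorem antitone_reflect {β : ℕ → ℚ} (hβ : Antitone β) (r : ℕ) :
    Antitone (fun i => -β (r - 1 - i)) := fun _ _ h =>
  neg_le_neg (hβ (Nat.sub_le_sub_left h _))

theorem antitone_shift {β : ℕ → ℚ} (hβ : Antitone β) (k : ℕ) :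
    Antitone (fun i => β (i + k)) := fun _ _ h => hβ (Nat.add_le_add_right h k)

theorem one_le_row {β : ℕ → ℚ} (hβ : Antitone β) (r : ℕ) :
    1 ≤ ∏ j ∈ range r, ((j : ℚ) + 1 + β 0 - β (j + 1)) / ((j : ℚ) + 1) := by
  refine one_le_prod fun j _ => ?_
  rw [one_le_div (by positivity)]
  linarith [hβ (Nat.zero_le (j + 1))]

theorem one_le_slDim (r : ℕ) {β : ℕ → ℚ} (hβ : Antitone β) : 1 ≤ slDim r β := by
  induction r generalizing β with
  | zero => simp [slDim]
  | succ r ih =>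
    rw [slDim_succ]
    exact one_le_mul_of_one_le_of_one_le (one_le_row hβ r) (ih (antitone_shift hβ 1))

/-- Dropping the first `k` entries of a weight does not increase the dimension. -/
theorem slDim_shift_le (r k : ℕ) {β : ℕ → ℚ} (hβ : Antitone β) :
    slDim r (fun i => β (i + k)) ≤ slDim (r + k) β := by
  induction k generalizing β with
  | zero => simp
  | succ k ih =>
    rw [← add_assoc, slDim_succ]
    have h := ih (antitone_shift hβ 1)
    have h1 := one_le_slDim (r + k) (antitone_shift hβ 1)
    refine le_trans ?_ (le_mul_of_one_le_left (zero_le_one.trans h1) (one_le_row hβ _))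
    simpa only [add_assoc] using h

theorem prod_range_add_two_div (r : ℕ) :
    ∏ j ∈ range r, ((j : ℚ) + 2) / ((j : ℚ) + 1) = r + 1 := by
  induction r with
  | zero => simp
  | succ r ih =>
    rw [prod_range_succ, ih]
    push_cast
    field_simp
    ring

theorem prod_range_add_three_div (r : ℕ) :
    ∏ j ∈ range r, ((j : ℚ) + 3) / ((j : ℚ) + 1) = (r + 1) * (r + 2) / 2 := by
  induction r with
  | zero => simp
  | succ r ih =>
    rw [prod_range_succ, ih]
    push_cast
    field_simp
    ring

theorem prod_range_add_three_div_add_two (r : ℕ) :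
    ∏ j ∈ range r, ((j : ℚ) + 3) / ((j : ℚ) + 2) = (r + 2) / 2 := by
  induction r with
  | zero => simp
  | succ r ih =>
    rw [prod_range_succ, ih]
    push_cast
    field_simp
    ring

theorem add_one_le_row (r : ℕ) {β : ℕ → ℚ} (hβ : Antitone β) (h : β 1 + 1 ≤ β 0) :
    (r : ℚ) + 1 ≤ ∏ j ∈ range r, ((j : ℚ) + 1 + β 0 - β (j + 1)) / ((j : ℚ) + 1) := by
  rw [← prod_range_add_two_div]
  refine prod_le_prod (fun j _ => by positivity) fun j _ => ?_
  have := hβ (Nat.le_add_left 1 j)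
  gcongr
  linarith

theorem le_slDim_of_first_descent (r : ℕ) {β : ℕ → ℚ} (hβ : Antitone β)
    (h : β 1 + 1 ≤ β 0) : (r : ℚ) + 1 ≤ slDim (r + 1) β := by
  have h1 := add_one_le_row r hβ h
  rw [slDim_succ]
  exact h1.trans (le_mul_of_one_le_right (le_trans (by positivity) h1)
    (one_le_slDim r (antitone_shift hβ 1)))

theorem le_slDim_of_first_descent_two (r : ℕ) {β : ℕ → ℚ} (hβ : Antitone β)
    (h : β 1 + 2 ≤ β 0) : ((r : ℚ) + 1) * (r + 2) / 2 ≤ slDim (r + 1) β := by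
  have h1 : ((r : ℚ) + 1) * (r + 2) / 2 ≤
      ∏ j ∈ range r, ((j : ℚ) + 1 + β 0 - β (j + 1)) / ((j : ℚ) + 1) := by
    rw [← prod_range_add_three_div]
    refine prod_le_prod (fun j _ => by positivity) fun j _ => ?_
    have := hβ (Nat.le_add_left 1 j)
    gcongr
    linarith
  rw [slDim_succ]
  exact h1.trans (le_mul_of_one_le_right (le_trans (by positivity) h1)
    (one_le_slDim r (antitone_shift hβ 1)))

theorem le_slDim_of_second_descent (r : ℕ) {β : ℕ → ℚ} (hβ : Antitone β)
    (h : β 2 + 1 ≤ β 1) : ((r : ℚ) + 1) * (r + 2) / 2 ≤ slDim (r + 2) β := by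
  have h1 : ((r : ℚ) + 2) / 2 ≤
      ∏ j ∈ range (r + 1), ((j : ℚ) + 1 + β 0 - β (j + 1)) / ((j : ℚ) + 1) := by
    rw [prod_range_succ', ← prod_range_add_three_div_add_two]
    refine (le_mul_of_one_le_right (prod_nonneg fun j _ => ?_) ?_).trans'
      (prod_le_prod (fun j _ => by positivity) fun j _ => ?_)
    · have := hβ (Nat.zero_le (j + 1 + 1))
      refine div_nonneg ?_ (by positivity)
      have : (0 : ℚ) ≤ ((j + 1 : ℕ) : ℚ) := by positivity
      linarith
    · have := hβ (Nat.zero_le 1)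
      simp
      linarith
    · have h2 := hβ (by omega : 2 ≤ j + 1 + 1)
      have h3 := hβ (Nat.zero_le 1)
      push_cast
      rw [add_assoc (j : ℚ) 1 1, one_add_one_eq_two]
      gcongr
      linarith
  have h2 := le_slDim_of_first_descent r (antitone_shift hβ 1) h
  rw [slDim_succ]
  calc ((r : ℚ) + 1) * (r + 2) / 2 = (r + 2) / 2 * (r + 1) := by ring
    _ ≤ _ := mul_le_mul h1 h2 (by positivity) (le_trans (by positivity) h1)

theorem le_slDim_of_last_descent (r : ℕ) {β : ℕ → ℚ} (hβ : Antitone β)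
    (h : β (r + 1) + 1 ≤ β r) : (r : ℚ) + 2 ≤ slDim (r + 2) β := by
  have := le_slDim_of_first_descent (r + 1) (antitone_reflect hβ (r + 2)) (by
    simp
    linarith)
  rw [slDim_reflect] at this
  push_cast at this
  linarith

theorem le_slDim_of_last_descent_two (r : ℕ) {β : ℕ → ℚ} (hβ : Antitone β)
    (h : β (r + 1) + 2 ≤ β r) : ((r : ℚ) + 2) * (r + 3) / 2 ≤ slDim (r + 2) β := by
  have := le_slDim_of_first_descent_two (r + 1) (antitone_reflect hβ (r + 2)) (by
    simp
    linarith)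
  rw [slDim_reflect] at this
  push_cast at this
  linarith

theorem le_slDim_of_first_last_descent (r : ℕ) {β : ℕ → ℚ} (hβ : Antitone β)
    (h0 : β 1 + 1 ≤ β 0) (h : β (r + 2) + 1 ≤ β (r + 1)) :
    ((r : ℚ) + 3) * (r + 2) ≤ slDim (r + 3) β := by
  have h1 := add_one_le_row (r + 2) hβ h0
  have h2 := le_slDim_of_last_descent r (antitone_shift hβ 1) h
  rw [slDim_succ]
  push_cast at h1
  exact mul_le_mul (by linarith) h2 (by positivity) (le_trans (by positivity) h1)

theorem le_slDim_of_descent_left (a b : ℕ) {β : ℕ → ℚ} (hβ : Antitone β)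
    (h : β (a + 2) + 1 ≤ β (a + 1)) :
    ((b : ℚ) + 3) * (b + 4) / 2 ≤ slDim (a + b + 4) β := by
  have h1 := le_slDim_of_second_descent (b + 2) (antitone_shift hβ a) (by
    rw [add_comm 2 a, add_comm 1 a]
    exact h)
  have h2 := slDim_shift_le (b + 2 + 2) a hβ
  rw [show b + 2 + 2 + a = a + b + 4 by ring] at h2
  push_cast at h1
  linarith

theorem le_slDim_of_descent_right (a b : ℕ) {β : ℕ → ℚ} (hβ : Antitone β)
    (h : β (a + 2) + 1 ≤ β (a + 1)) :
    ((a : ℚ) + 3) * (a + 4) / 2 ≤ slDim (a + b + 4) β := by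
  have h1 := le_slDim_of_descent_left b a (antitone_reflect hβ (a + b + 4)) (by
    rw [show a + b + 4 - 1 - (b + 2) = a + 1 by omega,
      show a + b + 4 - 1 - (b + 1) = a + 2 by omega]
    linarith)
  rw [add_comm b a, slDim_reflect] at h1
  exact h1

theorem lt_slDim_of_middle_descent (a b : ℕ) {β : ℕ → ℚ} (hβ : Antitone β)
    (h : β (a + 2) + 1 ≤ β (a + 1)) :
    2 * ((a : ℚ) + b + 4) - 4 < slDim (a + b + 4) β := by
  have h1 := le_slDim_of_descent_left a b hβ h
  have h2 := le_slDim_of_descent_right a b hβ h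
  nlinarith [sq_nonneg ((a : ℚ) - b), sq_nonneg ((a : ℚ) + b - 1)]

/-- Nontrivial irreducible representations of `sl(m)` have dimension at least `m`, and
only the standard representation and its dual have dimension at most `2m - 4`. -/
theorem le_slDim_and_eq_fundamental (r : ℕ) {β : ℕ → ℚ} (hβ : Antitone β)
    (hZ : ∀ i, ∃ z : ℤ, β i = z) (hlast : β (r + 2) = 0) (h0 : β 0 ≠ 0)
    (hdim : slDim (r + 3) β ≤ 2 * ((r : ℚ) + 3) - 4) :
    (r : ℚ) + 3 ≤ slDim (r + 3) β ∧
      ((β 0 = 1 ∧ β 1 = 0) ∨ ∀ j, j ≤ r + 1 → β j = 1) := by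
  have step : ∀ i j : ℕ, ∀ c : ℤ, β j + c < β i → β j + c + 1 ≤ β i := by
    intro i j c h
    obtain ⟨x, hx⟩ := hZ i
    obtain ⟨y, hy⟩ := hZ j
    rw [hx, hy] at h ⊢
    exact_mod_cast h
  have hmid : ∀ k, k ≤ r → β (k + 1) = β 1 := by
    intro k
    induction k with
    | zero => intro _; rfl
    | succ k ih =>
      intro hk
      rw [← ih (by omega)]
      refine le_antisymm (hβ (by omega)) (not_lt.1 fun hlt => ?_)
      obtain ⟨b, rfl⟩ := Nat.exists_eq_add_of_le hk
      have h1 := step (k + 1) (k + 2) 0 (by simpa using hlt)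
      have h2 := lt_slDim_of_middle_descent k b hβ (by simpa using h1)
      rw [show k + 1 + b + 3 = k + b + 4 by ring] at hdim
      push_cast at hdim
      linarith
  have hr : (0 : ℚ) ≤ r := r.cast_nonneg
  by_cases h01 : β 1 < β 0
  · have h1 : β 1 + 1 ≤ β 0 := by simpa using step 0 1 0 (by simpa using h01)
    have hlast' : β (r + 1) = 0 := by
      rw [← hlast]
      refine le_antisymm (not_lt.1 fun hlt => ?_) (hβ (by omega))
      have h2 : β (r + 2) + 1 ≤ β (r + 1) := by
        simpa using step (r + 1) (r + 2) 0 (by simpa using hlt)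
      have h3 := le_slDim_of_first_last_descent r hβ h1 h2
      nlinarith
    have hβ1 : β 1 = 0 := by rw [← hmid r le_rfl, hlast']
    have h4 := le_slDim_of_first_descent (r + 2) hβ h1
    refine ⟨by push_cast at h4; linarith, Or.inl ⟨?_, hβ1⟩⟩
    refine le_antisymm (not_lt.1 fun hlt => ?_) (by linarith)
    have h2 := step 0 1 1 (by rw [hβ1]; simpa using hlt)
    have h3 := le_slDim_of_first_descent_two (r + 2) hβ (by push_cast at h2; linarith)
    push_cast at h3
    nlinarith
  · have h01' : β 0 = β 1 := le_antisymm (not_lt.1 h01) (hβ (Nat.zero_le 1))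
    have hr1 : β (r + 1) = β 0 := by rw [hmid r le_rfl, h01']
    have hpos : β (r + 2) < β (r + 1) := by
      rw [hr1]
      exact lt_of_le_of_ne (hβ (Nat.zero_le _)) (by rw [hlast]; exact h0.symm)
    have h1 : β (r + 2) + 1 ≤ β (r + 1) := by
      simpa using step (r + 1) (r + 2) 0 (by simpa using hpos)
    have h4 := le_slDim_of_last_descent (r + 1) hβ h1
    have h_one : β (r + 1) = 1 := by
      refine le_antisymm (not_lt.1 fun hlt => ?_) (by linarith)
      have h2 := step (r + 1) (r + 2) 1 (by rw [hlast]; simpa using hlt)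
      have h3 := le_slDim_of_last_descent_two (r + 1) hβ (by push_cast at h2; linarith)
      push_cast at h3
      nlinarith
    refine ⟨by push_cast at h4; linarith, Or.inr fun j hj => ?_⟩
    exact le_antisymm ((hβ (Nat.zero_le j)).trans (by linarith)) (h_one ▸ hβ hj)

theorem slDim_two (β : ℕ → ℚ) : slDim 2 β = 1 + β 0 - β 1 := by
  simp [slDim, prod_range_succ]

/-- For `n ≥ 5`, a nonzero weight `β` for `Gr(2,n)` of rank at most `2(n−2) − 4`
has zero tail, or is `(r,r,1,0,…,0)`, or is `(s,s,1,…,1,0)`. -/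
theorem stmt7 (n : ℕ) (hn : 5 ≤ n) (β : ℕ → ℚ) (hβ : IsGrWeight n β) (hnz : β ≠ 0)
    (hr : grRank 2 n β ≤ 2 * ((n : ℚ) - 2) - 4) :
    (∀ j, 2 ≤ j → β j = 0) ∨
    (∃ r : ℤ, 1 ≤ r ∧ β 0 = (r : ℚ) ∧ β 1 = (r : ℚ) ∧ β 2 = 1 ∧ ∀ j, 3 ≤ j → β j = 0) ∨
    (∃ s : ℤ, 1 ≤ s ∧ β 0 = (s : ℚ) ∧ β 1 = (s : ℚ) ∧ ∀ j, 2 ≤ j → j < n - 1 → β j = 1) := by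
  obtain ⟨hZ, hanti, hzero⟩ := hβ
  obtain ⟨r, rfl⟩ := Nat.exists_eq_add_of_le hn
  have hβ : Antitone β := fun i j h => hanti i j h
  have htail : Antitone (fun i => β (2 + i)) := fun i j h => hβ (by omega)
  by_cases h2 : β 2 = 0
  · left
    intro j hj
    refine le_antisymm (h2 ▸ hβ hj) ?_
    rw [← hzero (max j (5 + r)) (by omega)]
    exact hβ (le_max_left _ _)
  right
  rw [grRank, slDim_two, show 5 + r - 2 = r + 3 by omega] at hr
  push_cast at hr
  have h01 := hβ (Nat.zero_le 1)
  have hD := one_le_slDim (r + 3) htail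
  obtain ⟨hle, hcases⟩ := le_slDim_and_eq_fundamental r htail (fun i => hZ _)
    (hzero _ (by omega)) h2 (by nlinarith)
  obtain ⟨x, hx⟩ := hZ 0
  obtain ⟨y, hy⟩ := hZ 1
  have hxy : y = x := by
    rw [hx, hy] at h01 hr
    refine le_antisymm (by exact_mod_cast h01) (not_lt.1 fun hlt => ?_)
    have hlt' : (y : ℚ) + 1 ≤ x := by exact_mod_cast hlt
    nlinarith
  have hx1 : β 2 = 1 → 1 ≤ x := fun h => by
    have := hβ (Nat.zero_le 2)
    rw [h, hx] at this
    exact_mod_cast this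
  rcases hcases with ⟨hb2, hb3⟩ | hb
  · refine Or.inl ⟨x, hx1 hb2, hx, hxy ▸ hy, hb2, fun j hj => ?_⟩
    refine le_antisymm (hb3 ▸ hβ hj) ?_
    rw [← hzero (max j (5 + r)) (by omega)]
    exact hβ (le_max_left _ _)
  · refine Or.inr ⟨x, hx1 (hb 0 (by omega)), hx, hxy ▸ hy, fun j hj hj' => ?_⟩
    obtain ⟨i, rfl⟩ := Nat.exists_eq_add_of_le hj
    exact hb i (by omega)
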